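/- Let C : ℝⁿ → ℝ be strictly convex, q-homogeneous with q > 1, and such that L = ∫ e^{-C(x)} dx < ∞. Then for all smooth enough g on ℝⁿ with finite integrals, Ent_{dx}(e^g) ≤ (n/p) (∫ e^g dx) · log( (p / (n e^{p−1} L^{p/n})) · (∫ C*(−∇g) e^g dx) / (∫ e^g dx) ), where 1/p + 1/q = 1 and C* is the Legendre transform of C. -/

import Mathlib

open MeasureTheory Real
open scoped RealInnerProductSpace

/-- The Legendre (Fenchel) transform of `C`. -/
noncomputable def legendre {n : ℕ} (C : EuclideanSpace ℝ (Fin n) → ℝ)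
    (y : EuclideanSpace ℝ (Fin n)) : ℝ :=
  ⨆ z, ⟪y, z⟫ - C z

/-- The entropy of `f` with respect to `μ`. -/
noncomputable def Ent {n : ℕ} (μ : Measure (EuclideanSpace ℝ (Fin n)))
    (f : EuclideanSpace ℝ (Fin n) → ℝ) : ℝ :=
  ∫ x, f x * Real.log (f x / ∫ y, f y ∂μ) ∂μ

section EuclideanLogSobolev

open scoped ENNReal Pointwise

/-- One-dimensional Brunn–Minkowski inequality. -/
lemma volume_add_volume_le {A B D : Set ℝ} (hA : MeasurableSet A) (hB : MeasurableSet B)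
    (hA' : A.Nonempty) (hB' : B.Nonempty) (h : ∀ a ∈ A, ∀ b ∈ B, a + b ∈ D) :
    volume A + volume B ≤ volume D := by
  have key : ∀ K ⊆ A, IsCompact K → ∀ K' ⊆ B, IsCompact K' →
      volume K + volume K' ≤ volume D := by
    intro K hKA hK K' hKB hK'
    rcases K.eq_empty_or_nonempty with rfl | hne
    · obtain ⟨a, ha⟩ := hA'
      have : (fun y => a + y) '' K' ⊆ D := by
        rintro _ ⟨y, hy, rfl⟩
        exact h a ha y (hKB hy)
      simpa [Set.image_add_left, measure_preimage_add] using measure_mono (μ := volume) this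
    rcases K'.eq_empty_or_nonempty with rfl | hne'
    · obtain ⟨b, hb⟩ := hB'
      have : (fun y => y + b) '' K ⊆ D := by
        rintro _ ⟨y, hy, rfl⟩
        exact h y (hKA hy) b hb
      simpa [Set.image_add_right, measure_preimage_add_right] using
        measure_mono (μ := volume) this
    obtain ⟨a, haK, ha⟩ := hK.exists_isGreatest hne
    obtain ⟨b, hbK, hb⟩ := hK'.exists_isLeast hne'
    have h1 : volume ((fun y => y + b) '' K) = volume K := by
      simp [Set.image_add_right, measure_preimage_add_right]
    have h2 : volume ((fun y => a + y) '' K') = volume K' := by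
      simp [Set.image_add_left, measure_preimage_add]
    rw [← h1, ← h2, ← measure_union₀]
    · apply measure_mono
      rintro _ (⟨y, hy, rfl⟩ | ⟨y, hy, rfl⟩)
      · exact h y (hKA hy) b (hKB hbK)
      · exact h a (hKA haK) y (hKB hy)
    · exact (hK'.image (by fun_prop)).measurableSet.nullMeasurableSet
    · refine measure_mono_null (t := {a + b}) ?_ (by simp)
      rintro _ ⟨⟨y, hy, rfl⟩, ⟨z, hz, hyz⟩⟩
      have h3 := ha hy
      have h4 := hb hz
      simp only [Set.mem_singleton_iff] at hyz ⊢
      linarith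
  rw [hA.measure_eq_iSup_isCompact, hB.measure_eq_iSup_isCompact]
  simp only [iSup_and']
  refine ENNReal.biSup_add_biSup_le' ⟨∅, by simp⟩ ⟨∅, by simp⟩ fun K hK K' hK' => ?_
  exact key K hK.1 hK.2 K' hK'.1 hK'.2

lemma lintegral_eq_mul_lintegral_meas_lt {α : Type*} [MeasurableSpace α] (μ : Measure α)
    {f : α → ℝ≥0∞} (hf : Measurable f) (hf' : ∀ x, f x ≠ ∞) {a : ℝ≥0∞} (ha : a ≠ 0)
    (ha' : a ≠ ∞) :
    ∫⁻ x, f x ∂μ = a * ∫⁻ s in Set.Ioi (0 : ℝ), μ {x | ENNReal.ofReal s * a < f x} := by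
  have h0 : 0 < a.toReal := ENNReal.toReal_pos ha ha'
  have h := lintegral_eq_lintegral_meas_lt μ (f := fun x => (f x).toReal / a.toReal)
    (Filter.Eventually.of_forall fun x => by positivity)
    (hf.ennreal_toReal.div_const _).aemeasurable
  have h1 : ∀ x, ENNReal.ofReal ((f x).toReal / a.toReal) = f x / a := fun x => by
    rw [ENNReal.ofReal_div_of_pos h0, ENNReal.ofReal_toReal (hf' x), ENNReal.ofReal_toReal ha']
  simp only [h1] at h
  have h2 : ∫⁻ x, f x ∂μ = a * ∫⁻ x, f x / a ∂μ := by
    rw [← lintegral_const_mul _ (hf.div_const a)]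
    congr with x
    rw [ENNReal.mul_div_cancel ha ha']
  rw [h2, h]
  congr 1
  refine setLIntegral_congr_fun measurableSet_Ioi fun s hs => ?_
  congr 1
  ext x
  simp only [Set.mem_ofPred_eq]
  rw [lt_div_iff₀ h0, ← ENNReal.toReal_lt_toReal (ENNReal.mul_ne_top ENNReal.ofReal_ne_top ha')
    (hf' x), ENNReal.toReal_mul, ENNReal.toReal_ofReal (le_of_lt hs)]

lemma ENNReal.geom_mean_le_arith_mean2 {t : ℝ} (h0 : 0 < t) (h1 : t < 1) (x y : ℝ≥0∞) :
    x ^ (1 - t) * y ^ t ≤ ENNReal.ofReal (1 - t) * x + ENNReal.ofReal t * y := by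
  have h2 : 0 < 1 - t := by linarith
  rcases eq_or_ne x ∞ with rfl | hx
  · rw [ENNReal.mul_top (by simpa using h1)]; simp
  rcases eq_or_ne y ∞ with rfl | hy
  · rw [ENNReal.mul_top (by simpa using h0)]; simp
  lift x to NNReal using hx
  lift y to NNReal using hy
  have := NNReal.geom_mean_le_arith_mean2_weighted (1 - t).toNNReal t.toNNReal x y
    (by rw [← Real.toNNReal_add h2.le h0.le]; simp)
  rw [Real.coe_toNNReal _ h2.le, Real.coe_toNNReal _ h0.le] at this
  rw [← ENNReal.coe_rpow_of_nonneg _ h2.le, ← ENNReal.coe_rpow_of_nonneg _ h0.le]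
  rw [ENNReal.ofReal, ENNReal.ofReal]
  exact_mod_cast this

/-- The Prékopa–Leindler inequality with weight `t` for the measure `μ`. -/
def PrekopaLeindler {E : Type*} [AddCommGroup E] [Module ℝ E] [MeasurableSpace E]
    (μ : Measure E) (t : ℝ) : Prop :=
  ∀ u v w : E → ℝ≥0∞, Measurable u → Measurable v → Measurable w →
    (∀ x y, u x ^ (1 - t) * v y ^ t ≤ w ((1 - t) • x + t • y)) →
    (∫⁻ x, u x ∂μ) ^ (1 - t) * (∫⁻ x, v x ∂μ) ^ t ≤ ∫⁻ x, w x ∂μ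

lemma prekopaLeindler_real_of_bounded {t : ℝ} (h0 : 0 < t) (h1 : t < 1) {u v w : ℝ → ℝ≥0∞}
    (hu : Measurable u) (hv : Measurable v) (hw : Measurable w)
    (h : ∀ x y, u x ^ (1 - t) * v y ^ t ≤ w ((1 - t) • x + t • y))
    {k : ℝ≥0∞} (hk : k ≠ ∞) (huk : ∀ x, u x ≤ k) (hvk : ∀ x, v x ≤ k) :
    (∫⁻ x, u x) ^ (1 - t) * (∫⁻ x, v x) ^ t ≤ ∫⁻ x, w x := by
  have h2 : 0 < 1 - t := by linarith
  set a := ⨆ x, u x with ha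
  set b := ⨆ x, v x with hb
  have hua : ∀ x, u x ≤ a := le_iSup u
  have hvb : ∀ x, v x ≤ b := le_iSup v
  have ha' : a ≠ ∞ := ne_top_of_le_ne_top hk (iSup_le huk)
  have hb' : b ≠ ∞ := ne_top_of_le_ne_top hk (iSup_le hvk)
  rcases eq_or_ne a 0 with ha0 | ha0
  · have : ∀ x, u x = 0 := fun x => by simpa [ha0] using hua x
    simp [this, h2]
  rcases eq_or_ne b 0 with hb0 | hb0
  · have : ∀ x, v x = 0 := fun x => by simpa [hb0] using hvb x
    simp [this, h0]
  set c := a ^ (1 - t) * b ^ t with hc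
  have hc0 : c ≠ 0 := mul_ne_zero (by simp [ENNReal.rpow_eq_zero_iff, ha0, ha'])
    (by simp [ENNReal.rpow_eq_zero_iff, hb0, hb'])
  have hc' : c ≠ ∞ := ENNReal.mul_ne_top (ENNReal.rpow_ne_top_of_nonneg h2.le ha')
    (ENNReal.rpow_ne_top_of_nonneg h0.le hb')
  have level : ∀ s ∈ Set.Ioi (0 : ℝ),
      ENNReal.ofReal (1 - t) * volume {x | ENNReal.ofReal s * a < u x} +
        ENNReal.ofReal t * volume {x | ENNReal.ofReal s * b < v x} ≤
      volume {x | ENNReal.ofReal s * c < min (w x) c} := by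
    intro s hs
    rcases le_or_gt 1 s with hs1 | hs1
    · have h3 : 1 ≤ ENNReal.ofReal s := by simpa using hs1
      have e1 : {x | ENNReal.ofReal s * a < u x} = ∅ := by
        ext x
        simpa using (hua x).trans (le_mul_of_one_le_left' h3)
      have e2 : {x | ENNReal.ofReal s * b < v x} = ∅ := by
        ext x
        simpa using (hvb x).trans (le_mul_of_one_le_left' h3)
      simp [e1, e2]
    have hs3 : ENNReal.ofReal s < 1 := by simpa using hs1
    have lt_self : ∀ d : ℝ≥0∞, d ≠ 0 → d ≠ ∞ → ENNReal.ofReal s * d < d := fun d hd hd' => by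
      simpa using ENNReal.mul_lt_mul_left hd hd' hs3
    obtain ⟨x₀, hx₀⟩ := lt_iSup_iff.1 (lt_self a ha0 ha')
    obtain ⟨y₀, hy₀⟩ := lt_iSup_iff.1 (lt_self b hb0 hb')
    have hA : ENNReal.ofReal (1 - t) * volume {x | ENNReal.ofReal s * a < u x} =
        volume ((1 - t) • {x | ENNReal.ofReal s * a < u x}) := by
      rw [Measure.addHaar_smul]; simp [abs_of_pos h2]
    have hB : ENNReal.ofReal t * volume {x | ENNReal.ofReal s * b < v x} =
        volume (t • {x | ENNReal.ofReal s * b < v x}) := by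
      rw [Measure.addHaar_smul]; simp [abs_of_pos h0]
    rw [hA, hB]
    refine volume_add_volume_le
      ((measurableSet_lt measurable_const hu).const_smul₀ _)
      ((measurableSet_lt measurable_const hv).const_smul₀ _)
      (Set.Nonempty.smul_set ⟨x₀, hx₀⟩) (Set.Nonempty.smul_set ⟨y₀, hy₀⟩) ?_
    rintro _ ⟨x, hx, rfl⟩ _ ⟨y, hy, rfl⟩
    refine lt_min (lt_of_lt_of_le ?_ (h x y)) (lt_self c hc0 hc')
    have hs4 : ENNReal.ofReal s * c =
        (ENNReal.ofReal s * a) ^ (1 - t) * (ENNReal.ofReal s * b) ^ t := by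
      rw [ENNReal.mul_rpow_of_nonneg _ _ h2.le, ENNReal.mul_rpow_of_nonneg _ _ h0.le, hc]
      have : ENNReal.ofReal s = ENNReal.ofReal s ^ (1 - t) * ENNReal.ofReal s ^ t := by
        rw [← ENNReal.rpow_add_of_nonneg _ _ h2.le h0.le]; simp
      nth_rewrite 1 [this]
      ring
    rw [hs4]
    exact ENNReal.mul_lt_mul (ENNReal.rpow_lt_rpow hx h2) (ENNReal.rpow_lt_rpow hy h0)
  have hU := lintegral_eq_mul_lintegral_meas_lt volume hu
    (fun x => ne_top_of_le_ne_top hk (huk x)) ha0 ha'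
  have hV := lintegral_eq_mul_lintegral_meas_lt volume hv
    (fun x => ne_top_of_le_ne_top hk (hvk x)) hb0 hb'
  have hW := lintegral_eq_mul_lintegral_meas_lt volume (hw.min measurable_const)
    (fun x => ne_top_of_le_ne_top hc' (min_le_right (w x) c)) hc0 hc'
  have mono : Monotone fun s : ℝ => ENNReal.ofReal s := fun _ _ => ENNReal.ofReal_le_ofReal
  have meas : ∀ (f : ℝ → ℝ≥0∞) (d : ℝ≥0∞),
      Measurable fun s : ℝ => volume {x | ENNReal.ofReal s * d < f x} := fun f d => by
    refine Antitone.measurable fun s s' hss => measure_mono fun x hx => ?_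
    exact lt_of_le_of_lt (mul_le_mul_left (mono hss) d) hx
  refine le_trans ?_ (lintegral_mono fun x => min_le_left (w x) c)
  rw [hU, hV, hW, ENNReal.mul_rpow_of_nonneg _ _ h2.le, ENNReal.mul_rpow_of_nonneg _ _ h0.le,
    mul_mul_mul_comm, ← hc]
  gcongr
  refine (ENNReal.geom_mean_le_arith_mean2 h0 h1 _ _).trans ?_
  rw [← lintegral_const_mul _ (meas u a), ← lintegral_const_mul _ (meas v b),
    ← lintegral_add_left ((meas u a).const_mul _)]
  exact setLIntegral_mono (meas _ c) level

lemma prekopaLeindler_real {t : ℝ} (h0 : 0 < t) (h1 : t < 1) :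
    PrekopaLeindler (volume : Measure ℝ) t := by
  intro u v w hu hv hw h
  have h2 : 0 < 1 - t := by linarith
  rcases eq_or_ne (∫⁻ x, u x) 0 with hU | hU
  · simp [hU, h2]
  rcases eq_or_ne (∫⁻ x, v x) 0 with hV | hV
  · simp [hV, h0]
  have lim : ∀ f : ℝ → ℝ≥0∞, Measurable f → Filter.Tendsto
      (fun k : ℕ => ∫⁻ x, min (f x) k) Filter.atTop (nhds (∫⁻ x, f x)) := by
    intro f hf
    refine lintegral_tendsto_of_tendsto_of_monotone
      (fun k => (hf.min measurable_const).aemeasurable)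
      (Filter.Eventually.of_forall fun x i j hij => by dsimp only; gcongr)
      (Filter.Eventually.of_forall fun x => ?_)
    simpa using (tendsto_const_nhds (x := f x)).min ENNReal.tendsto_nat_nhds_top
  refine le_of_tendsto (ENNReal.Tendsto.mul ((lim u hu).ennrpow_const (1 - t)) (Or.inl ?_)
    ((lim v hv).ennrpow_const t) (Or.inl ?_)) (Filter.Eventually.of_forall fun k => ?_)
  · simp [ENNReal.rpow_eq_zero_iff, hU, h1.le]
  · simp [ENNReal.rpow_eq_zero_iff, hV, h0.le]
  refine prekopaLeindler_real_of_bounded h0 h1 (hu.min measurable_const)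
    (hv.min measurable_const) hw (fun x y => le_trans ?_ (h x y))
    (ENNReal.natCast_ne_top k) (fun x => min_le_right _ _) (fun x => min_le_right _ _)
  gcongr <;> exact min_le_left _ _

lemma PrekopaLeindler.prod {E F : Type*} [AddCommGroup E] [Module ℝ E] [MeasurableSpace E]
    [AddCommGroup F] [Module ℝ F] [MeasurableSpace F] {μ : Measure E} {ν : Measure F}
    [SFinite ν] {t : ℝ} (hμ : PrekopaLeindler μ t) (hν : PrekopaLeindler ν t) :
    PrekopaLeindler (μ.prod ν) t := by
  intro u v w hu hv hw h
  rw [lintegral_prod _ hu.aemeasurable, lintegral_prod _ hv.aemeasurable,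
    lintegral_prod _ hw.aemeasurable]
  exact hμ _ _ _ hu.lintegral_prod_right' hv.lintegral_prod_right' hw.lintegral_prod_right'
    fun x x' => hν _ _ _ (hu.comp measurable_prodMk_left)
      (hv.comp measurable_prodMk_left) (hw.comp measurable_prodMk_left)
      fun y y' => h (x, y) (x', y')

lemma PrekopaLeindler.of_measurePreserving {E F : Type*} [AddCommGroup E] [Module ℝ E]
    [MeasurableSpace E] [AddCommGroup F] [Module ℝ F] [MeasurableSpace F] {μ : Measure E}
    {ν : Measure F} {t : ℝ} (hμ : PrekopaLeindler μ t) (e : E →ₗ[ℝ] F)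
    (he : MeasurePreserving e μ ν) : PrekopaLeindler ν t := by
  intro u v w hu hv hw h
  rw [← he.lintegral_comp hu, ← he.lintegral_comp hv, ← he.lintegral_comp hw]
  refine hμ _ _ _ (hu.comp he.measurable) (hv.comp he.measurable) (hw.comp he.measurable)
    fun x y => ?_
  simpa using h (e x) (e y)

lemma prekopaLeindler_pi {t : ℝ} (h0 : 0 < t) (h1 : t < 1) (n : ℕ) :
    PrekopaLeindler (volume : Measure (Fin n → ℝ)) t := by
  induction n with
  | zero =>
    intro u v w hu hv hw h
    rw [volume_pi, Measure.pi_of_empty _ 0, lintegral_dirac, lintegral_dirac, lintegral_dirac]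
    simpa using h 0 0
  | succ n ih =>
    have e := (volume_preserving_piFinSuccAbove (fun _ : Fin (n + 1) => ℝ) 0).symm
    refine ((prekopaLeindler_real h0 h1).prod ih).of_measurePreserving
      { toFun := (MeasurableEquiv.piFinSuccAbove (fun _ : Fin (n + 1) => ℝ) 0).symm
        map_add' := fun x y => ?_
        map_smul' := fun c x => ?_ } e
    · ext i; refine Fin.cases ?_ (fun i => ?_) i <;> simp [MeasurableEquiv.piFinSuccAbove]
    · ext i; refine Fin.cases ?_ (fun i => ?_) i <;> simp [MeasurableEquiv.piFinSuccAbove]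

/-- The Prékopa–Leindler inequality on Euclidean space. -/
lemma prekopaLeindler_euclideanSpace {t : ℝ} (h0 : 0 < t) (h1 : t < 1) (n : ℕ) :
    PrekopaLeindler (volume : Measure (EuclideanSpace ℝ (Fin n))) t :=
  (prekopaLeindler_pi h0 h1 n).of_measurePreserving
    (WithLp.linearEquiv 2 ℝ (Fin n → ℝ)).symm.toLinearMap (PiLp.volume_preserving_toLp (Fin n))

variable {n : ℕ}

/-- The Prékopa–Leindler inequality for real-valued integrable functions. -/
lemma rpow_integral_mul_rpow_integral_le {t : ℝ} (h0 : 0 < t) (h1 : t < 1)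
    {u v w : EuclideanSpace ℝ (Fin n) → ℝ} (hu : Measurable u) (hv : Measurable v)
    (hw : Measurable w) (hu0 : 0 ≤ u) (hv0 : 0 ≤ v) (hw0 : 0 ≤ w) (hui : Integrable u)
    (hvi : Integrable v) (hwi : Integrable w)
    (h : ∀ x y, u x ^ (1 - t) * v y ^ t ≤ w ((1 - t) • x + t • y)) :
    (∫ x, u x) ^ (1 - t) * (∫ x, v x) ^ t ≤ ∫ x, w x := by
  have h2 : 0 < 1 - t := by linarith
  have key := prekopaLeindler_euclideanSpace h0 h1 n (fun x => ENNReal.ofReal (u x))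
    (fun x => ENNReal.ofReal (v x)) (fun x => ENNReal.ofReal (w x)) hu.ennreal_ofReal
    hv.ennreal_ofReal hw.ennreal_ofReal fun x y => by
      rw [ENNReal.ofReal_rpow_of_nonneg (hu0 x) h2.le, ENNReal.ofReal_rpow_of_nonneg (hv0 y) h0.le,
        ← ENNReal.ofReal_mul (Real.rpow_nonneg (hu0 x) _)]
      exact ENNReal.ofReal_le_ofReal (h x y)
  rw [← ofReal_integral_eq_lintegral_ofReal hui (.of_forall hu0),
    ← ofReal_integral_eq_lintegral_ofReal hvi (.of_forall hv0),
    ← ofReal_integral_eq_lintegral_ofReal hwi (.of_forall hw0),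
    ENNReal.ofReal_rpow_of_nonneg (integral_nonneg hu0) h2.le,
    ENNReal.ofReal_rpow_of_nonneg (integral_nonneg hv0) h0.le,
    ← ENNReal.ofReal_mul (Real.rpow_nonneg (integral_nonneg hu0) _),
    ENNReal.ofReal_le_ofReal_iff (integral_nonneg hw0)] at key
  exact key

lemma setIntegral_exp_closedBall_pos {f : EuclideanSpace ℝ (Fin n) → ℝ} (hf : Continuous f)
    {r : ℝ} (hr : 0 < r) : 0 < ∫ x in Metric.closedBall 0 r, Real.exp (f x) := by
  have hi : IntegrableOn (fun x => Real.exp (f x)) (Metric.closedBall 0 r) :=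
    (by fun_prop : Continuous fun x => Real.exp (f x)).continuousOn.integrableOn_compact
      (isCompact_closedBall 0 r)
  rw [setIntegral_pos_iff_support_of_nonneg_ae (.of_forall fun x => (Real.exp_pos _).le) hi]
  have : Function.support (fun x => Real.exp (f x)) = Set.univ := by
    ext x; simp [Real.exp_ne_zero]
  rw [this, Set.univ_inter]
  exact Metric.measure_closedBall_pos _ _ hr

/-- Jensen's inequality for the exponential. -/
lemma mul_exp_div_le_setIntegral {f φ : EuclideanSpace ℝ (Fin n) → ℝ} (hf : Continuous f)
    (hφ : Continuous φ) {r : ℝ} (hr : 0 < r) :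
    (∫ x in Metric.closedBall 0 r, Real.exp (f x)) *
        Real.exp ((∫ x in Metric.closedBall 0 r, Real.exp (f x) * φ x) /
          ∫ x in Metric.closedBall 0 r, Real.exp (f x)) ≤
      ∫ x in Metric.closedBall 0 r, Real.exp (f x + φ x) := by
  have hF := setIntegral_exp_closedBall_pos hf hr
  have hi : ∀ k : EuclideanSpace ℝ (Fin n) → ℝ, Continuous k →
      IntegrableOn k (Metric.closedBall 0 r) := fun k hk =>
    hk.continuousOn.integrableOn_compact (isCompact_closedBall 0 r)
  set F := ∫ x in Metric.closedBall 0 r, Real.exp (f x) with hFdef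
  set I := ∫ x in Metric.closedBall 0 r, Real.exp (f x) * φ x with hI
  have h1 : ∫ x in Metric.closedBall 0 r,
      Real.exp (I / F) * ((1 - I / F) * Real.exp (f x) + Real.exp (f x) * φ x) =
      F * Real.exp (I / F) := by
    rw [integral_const_mul, integral_add ((hi _ (by fun_prop)).const_mul _) (hi _ (by fun_prop)),
      integral_const_mul, ← hFdef, ← hI]
    field_simp
    ring
  rw [← h1]
  refine setIntegral_mono (hi _ (by fun_prop)) (hi _ (by fun_prop)) fun x => ?_
  have h2 := Real.add_one_le_exp (φ x - I / F)
  have h3 : Real.exp (f x + φ x) =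
      Real.exp (I / F) * Real.exp (f x) * Real.exp (φ x - I / F) := by
    rw [← Real.exp_add, ← Real.exp_add]; ring_nf
  have h4 : 0 < Real.exp (I / F) * Real.exp (f x) := by positivity
  dsimp only
  rw [h3]
  nlinarith [mul_le_mul_of_nonneg_left h2 h4.le]

/-- The finite-step inequality obtained from Prékopa–Leindler on balls. -/
lemma mul_le_log_integral_closedBall_sub {g C H : EuclideanSpace ℝ (Fin n) → ℝ}
    (hg : Continuous g) (hC : Continuous C) (hH : Continuous H) {t R M ε : ℝ} (h0 : 0 < t)
    (h1 : t < 1) (hR : 0 < R) (hM : 0 < M)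
    (h : ∀ x ∈ Metric.closedBall 0 M, ∀ y ∈ Metric.closedBall 0 R,
      g x - t * H x - t * ε - t * C y ≤ g (x + t • y)) :
    t * ((1 - t) * n + (∫ x in Metric.closedBall 0 M, Real.exp (g x) * (g x - H x)) /
        (∫ x in Metric.closedBall 0 M, Real.exp (g x)) -
        Real.log (∫ x in Metric.closedBall 0 M, Real.exp (g x)) +
        Real.log (∫ x in Metric.closedBall 0 R, Real.exp (-C x)) - ε) ≤
      Real.log (∫ x in Metric.closedBall 0 (M + t * R), Real.exp (g x)) -
        Real.log (∫ x in Metric.closedBall 0 M, Real.exp (g x)) := by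
  have h2 : 0 < 1 - t := by linarith
  have hi : ∀ (k : EuclideanSpace ℝ (Fin n) → ℝ) (r : ℝ), Continuous k →
      IntegrableOn k (Metric.closedBall 0 r) := fun k r hk =>
    hk.continuousOn.integrableOn_compact (isCompact_closedBall 0 r)
  have hind : ∀ (k : EuclideanSpace ℝ (Fin n) → ℝ) (r : ℝ), Continuous k →
      Measurable ((Metric.closedBall 0 r).indicator k) := fun k r hk =>
    hk.measurable.indicator measurableSet_closedBall
  set φ : EuclideanSpace ℝ (Fin n) → ℝ := fun x => t / (1 - t) * (g x - H x - ε) with hφ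
  have hφc : Continuous φ := by fun_prop
  set u : EuclideanSpace ℝ (Fin n) → ℝ :=
    (Metric.closedBall 0 M).indicator fun x => Real.exp (g x + φ x) with hu
  set v : EuclideanSpace ℝ (Fin n) → ℝ :=
    (Metric.closedBall 0 R).indicator fun x => Real.exp (-C x) with hv
  set w : EuclideanSpace ℝ (Fin n) → ℝ :=
    (Metric.closedBall 0 (M + t * R)).indicator fun x => Real.exp (g x) with hw
  have hui : Integrable u :=
    (hi _ _ (by fun_prop)).integrable_indicator measurableSet_closedBall
  have hvi : Integrable v :=
    (hi _ _ (by fun_prop)).integrable_indicator measurableSet_closedBall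
  have hwi : Integrable w :=
    (hi _ _ (by fun_prop)).integrable_indicator measurableSet_closedBall
  have hPL := rpow_integral_mul_rpow_integral_le h0 h1 (u := fun x => u ((1 - t) • x)) (v := v)
    (w := w) ((hind _ _ (by fun_prop)).comp (measurable_const_smul _)) (hind _ _ (by fun_prop))
    (hind _ _ (by fun_prop))
    (fun x => Set.indicator_nonneg (fun _ _ => (Real.exp_pos _).le) _)
    (fun x => Set.indicator_nonneg (fun _ _ => (Real.exp_pos _).le) _)
    (fun x => Set.indicator_nonneg (fun _ _ => (Real.exp_pos _).le) _)
    (hui.comp_smul h2.ne') hvi hwi ?_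
  swap
  · intro x' y
    set x := (1 - t) • x'
    have hw0 : 0 ≤ w (x + t • y) := Set.indicator_nonneg (fun _ _ => (Real.exp_pos _).le) _
    by_cases hx : x ∈ Metric.closedBall 0 M
    swap
    · rw [hu, Set.indicator_of_notMem hx, Real.zero_rpow h2.ne', zero_mul]
      exact hw0
    by_cases hy : y ∈ Metric.closedBall 0 R
    swap
    · rw [hv, Set.indicator_of_notMem hy, Real.zero_rpow h0.ne', mul_zero]
      exact hw0
    have hxy : x + t • y ∈ Metric.closedBall 0 (M + t * R) := by
      simp only [mem_closedBall_zero_iff] at hx hy ⊢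
      refine (norm_add_le _ _).trans ?_
      rw [norm_smul t, Real.norm_of_nonneg h0.le]
      gcongr
    rw [hu, hv, hw, Set.indicator_of_mem hx, Set.indicator_of_mem hy, Set.indicator_of_mem hxy,
      ← Real.exp_mul, ← Real.exp_mul, ← Real.exp_add, Real.exp_le_exp]
    refine le_trans (le_of_eq ?_) (h x hx y hy)
    simp only [hφ]
    field_simp
    ring
  rw [Measure.integral_comp_smul_of_nonneg volume u (1 - t) (hR := h2.le), hu, hv, hw,
    integral_indicator measurableSet_closedBall, integral_indicator measurableSet_closedBall,
    integral_indicator measurableSet_closedBall, finrank_euclideanSpace, Fintype.card_fin,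
    smul_eq_mul] at hPL
  have hJ := mul_exp_div_le_setIntegral hg hφc hM
  have hF := setIntegral_exp_closedBall_pos hg hM
  have hL : 0 < ∫ x in Metric.closedBall 0 R, Real.exp (-C x) :=
    setIntegral_exp_closedBall_pos (f := fun x => -C x) (by fun_prop) hR
  have hU : 0 < ∫ x in Metric.closedBall 0 M, Real.exp (g x + φ x) :=
    setIntegral_exp_closedBall_pos (f := fun x => g x + φ x) (by fun_prop) hM
  have hφI : ∫ x in Metric.closedBall 0 M, Real.exp (g x) * φ x =
      t / (1 - t) * ((∫ x in Metric.closedBall 0 M, Real.exp (g x) * (g x - H x)) -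
        ε * ∫ x in Metric.closedBall 0 M, Real.exp (g x)) := by
    rw [← integral_const_mul, ← integral_sub (hi _ _ (by fun_prop)) (hi _ _ (by fun_prop)),
      ← integral_const_mul]
    congr with x
    simp only [hφ]
    ring
  rw [hφI] at hJ
  set F := ∫ x in Metric.closedBall 0 M, Real.exp (g x)
  set I := ∫ x in Metric.closedBall 0 M, Real.exp (g x) * (g x - H x)
  set U := ∫ x in Metric.closedBall 0 M, Real.exp (g x + φ x)
  set L := ∫ x in Metric.closedBall 0 R, Real.exp (-C x)
  have hJ' := Real.log_le_log (by positivity) hJ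
  rw [Real.log_mul hF.ne' (Real.exp_pos _).ne', Real.log_exp] at hJ'
  have hPL' := Real.log_le_log (by positivity) hPL
  rw [Real.log_mul (by positivity) (by positivity), Real.log_rpow (by positivity),
    Real.log_rpow hL, Real.log_mul (by positivity) hU.ne', Real.log_inv, Real.log_pow] at hPL'
  have hlog : Real.log (1 - t) ≤ -t := by linarith [Real.log_le_sub_one_of_pos h2]
  have e1 : (1 - t) * (t / (1 - t) * (I - ε * F) / F) = t * (I / F - ε) := by
    field_simp
  have e2 := mul_le_mul_of_nonneg_left hJ' h2.le
  rw [mul_add, e1] at e2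
  have e3 : 0 ≤ (1 - t) * n := by positivity
  nlinarith [mul_le_mul_of_nonneg_left hlog e3]

/-- On compact sets a `C¹` function is approximated by its first-order expansion uniformly. -/
lemma exists_forall_le_apply_add_smul {g : EuclideanSpace ℝ (Fin n) → ℝ} (hg : ContDiff ℝ 1 g)
    {M R ε : ℝ} (hR : 0 < R) (hε : 0 < ε) :
    ∃ δ > 0, ∀ t, 0 < t → t < δ → ∀ x ∈ Metric.closedBall 0 M, ∀ y ∈ Metric.closedBall 0 R,
      g x + t * fderiv ℝ g x y - t * ε ≤ g (x + t • y) := by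
  have hcont : Continuous (fderiv ℝ g) := hg.continuous_fderiv one_ne_zero
  have hunif := (isCompact_closedBall (0 : EuclideanSpace ℝ (Fin n))
    (M + R)).uniformContinuousOn_of_continuous hcont.continuousOn
  rw [Metric.uniformContinuousOn_iff] at hunif
  obtain ⟨δ, hδ, hd⟩ := hunif (ε / R) (by positivity)
  refine ⟨min 1 (δ / R), by positivity, fun t h0 ht x hx y hy => ?_⟩
  have ht1 : t < 1 := ht.trans_le (min_le_left _ _)
  have ht2 : t * R < δ := (lt_div_iff₀ hR).1 (ht.trans_le (min_le_right _ _))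
  have htR : 0 ≤ t * R := by positivity
  simp only [mem_closedBall_zero_iff] at hx hy
  have hty : ‖t • y‖ ≤ t * R := by
    rw [norm_smul, Real.norm_of_nonneg h0.le]
    gcongr
  have hz : ∀ z ∈ Metric.closedBall x (t * R), z ∈ Metric.closedBall 0 (M + R) := by
    intro z hz
    rw [mem_closedBall_iff_norm] at hz
    rw [mem_closedBall_zero_iff]
    have := norm_le_insert' z x
    nlinarith
  have hbound : ∀ z ∈ Metric.closedBall x (t * R), ‖fderiv ℝ g z - fderiv ℝ g x‖ ≤ ε / R := by
    intro z hz'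
    rw [← dist_eq_norm]
    exact (hd z (hz z hz') x (hz x (Metric.mem_closedBall_self htR))
      ((Metric.mem_closedBall.1 hz').trans_lt ht2)).le
  have := (convex_closedBall x (t * R)).norm_image_sub_le_of_norm_hasFDerivWithin_le'
    (f := g) (f' := fderiv ℝ g) (φ := fderiv ℝ g x)
    (fun z _ => (hg.differentiable one_ne_zero z).hasFDerivAt.hasFDerivWithinAt) hbound
    (Metric.mem_closedBall_self htR)
    (show x + t • y ∈ Metric.closedBall x (t * R) by simpa [mem_closedBall_iff_norm] using hty)
  rw [add_sub_cancel_left, map_smul, smul_eq_mul, Real.norm_eq_abs] at this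
  have h3 : ε / R * ‖t • y‖ ≤ t * ε :=
    (mul_le_mul_of_nonneg_left hty (by positivity)).trans_eq (by field_simp)
  linarith [(abs_le.1 this).1]

lemma exists_sub_le_div_of_sub_le {f : ℕ → ℝ} {N : ℕ} (hN : 0 < N) {D : ℝ} (h : f N - f 0 ≤ D) :
    ∃ k < N, f (k + 1) - f k ≤ D / N := by
  by_contra! hc
  have h1 : ∑ _k ∈ Finset.range N, D / N < ∑ k ∈ Finset.range N, (f (k + 1) - f k) :=
    Finset.sum_lt_sum_of_nonempty (by simpa using hN.ne') fun k hk => hc k (Finset.mem_range.1 hk)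
  rw [Finset.sum_range_sub, Finset.sum_const, Finset.card_range, nsmul_eq_mul,
    mul_div_cancel₀ _ (by positivity)] at h1
  linarith

lemma tendsto_setIntegral_closedBall {f : EuclideanSpace ℝ (Fin n) → ℝ} (hf : Integrable f) :
    Filter.Tendsto (fun r : ℝ => ∫ x in Metric.closedBall 0 r, f x) Filter.atTop
      (nhds (∫ x, f x)) := by
  have h := tendsto_setIntegral_of_monotone (μ := volume) (f := f)
    (s := fun r : ℝ => Metric.closedBall (0 : EuclideanSpace ℝ (Fin n)) r)
    (fun _ => measurableSet_closedBall) (fun _ _ h => Metric.closedBall_subset_closedBall h)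
    hf.integrableOn
  have hU : ⋃ r : ℝ, Metric.closedBall (0 : EuclideanSpace ℝ (Fin n)) r = Set.univ :=
    Set.eq_univ_of_forall fun x => Set.mem_iUnion.2 ⟨‖x‖, by simp⟩
  rwa [hU, setIntegral_univ] at h

/-- A logarithmic Sobolev inequality for costs `C` and functions `H` satisfying Young's inequality
along the gradient of `g`. -/
lemma log_sobolev_of_young {g C H : EuclideanSpace ℝ (Fin n) → ℝ}
    (hg : ContDiff ℝ 1 g) (hC : Continuous C) (hH : Continuous H)
    (hL : Integrable fun x => Real.exp (-C x)) (hgi : Integrable fun x => Real.exp (g x))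
    (hgi' : Integrable fun x => Real.exp (g x) * (g x - H x))
    (hyoung : ∀ x y, -(fderiv ℝ g x y) ≤ C y + H x) :
    n + (∫ x, Real.exp (g x) * (g x - H x)) / (∫ x, Real.exp (g x)) -
      Real.log (∫ x, Real.exp (g x)) + Real.log (∫ x, Real.exp (-C x)) ≤ 0 := by
  set Z := ∫ x, Real.exp (g x) with hZdef
  set Λ := ∫ x, Real.exp (-C x) with hΛdef
  have hZ : 0 < Z := integral_exp_pos hgi
  have hΛ : 0 < Λ := integral_exp_pos hL
  set F : ℝ → ℝ := fun M => ∫ x in Metric.closedBall 0 M, Real.exp (g x) with hF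
  set I : ℝ → ℝ := fun M => ∫ x in Metric.closedBall 0 M, Real.exp (g x) * (g x - H x) with hI
  set W := ∫ x, Real.exp (g x) * (g x - H x)
  have hFlim : Filter.Tendsto F Filter.atTop (nhds Z) := tendsto_setIntegral_closedBall hgi
  have hΦlim : Filter.Tendsto (fun M => I M / F M - Real.log (F M)) Filter.atTop
      (nhds (W / Z - Real.log Z)) :=
    ((tendsto_setIntegral_closedBall hgi').div hFlim hZ.ne').sub (hFlim.log hZ.ne')
  have hΛlim := (tendsto_setIntegral_closedBall hL).log hΛ.ne'
  have hFpos : ∀ M, 0 < M → 0 < F M := fun M hM => setIntegral_exp_closedBall_pos hg.continuous hM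
  have hFle : ∀ M, F M ≤ Z := fun M =>
    setIntegral_le_integral hgi (.of_forall fun x => (Real.exp_pos _).le)
  refine le_of_forall_pos_le_add fun η' hη' => ?_
  obtain ⟨η, hη, rfl⟩ : ∃ η > 0, η' = 5 * η := ⟨η' / 5, by positivity, by ring⟩
  obtain ⟨R, hRΛ, hR⟩ := ((hΛlim.eventually_const_lt (sub_lt_self _ hη)).and
    (Filter.eventually_gt_atTop 0)).exists
  obtain ⟨M₀, hM₀⟩ := Filter.eventually_atTop.1 ((hΦlim.eventually_const_lt
    (sub_lt_self _ hη)).and (Filter.eventually_gt_atTop 0))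
  have hM₀pos : 0 < M₀ := (hM₀ M₀ le_rfl).2
  set D := Real.log Z - Real.log (F M₀) with hD
  have hD0 : 0 ≤ D := sub_nonneg.2 (Real.log_le_log (hFpos _ hM₀pos) (hFle _))
  set T := (D + 1) / η with hT
  have hTpos : 0 < T := by positivity
  obtain ⟨δ, hδ, hlin⟩ := exists_forall_le_apply_add_smul hg (M := M₀ + T * R) hR hη
  have hsmall : Filter.Tendsto (fun N : ℕ => T / N) Filter.atTop (nhds 0) :=
    tendsto_const_div_atTop_nhds_zero_nat T
  have hnη : 0 < η / (n + 1) := by positivity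
  obtain ⟨N, ⟨⟨hN1, hNδ⟩, hNη⟩, hN⟩ := ((((hsmall.eventually_lt_const one_pos).and
    (hsmall.eventually_lt_const hδ)).and (hsmall.eventually_lt_const hnη)).and
    (Filter.eventually_gt_atTop 0)).exists
  have hNpos : (0 : ℝ) < N := by exact_mod_cast hN
  set t := T / N with ht
  have ht0 : 0 < t := by positivity
  obtain ⟨k, hk, hslope⟩ := exists_sub_le_div_of_sub_le
    (f := fun k : ℕ => Real.log (F (M₀ + k * (t * R)))) hN (D := D) (by
      simp only [Nat.cast_zero, zero_mul, add_zero, hD]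
      gcongr
      · exact hFpos _ (by positivity)
      · exact hFle _)
  set M := M₀ + k * (t * R) with hM
  have hMM₀ : M₀ ≤ M := le_add_of_nonneg_right (by positivity)
  have hMT : M ≤ M₀ + T * R := by
    have : (k : ℝ) * t ≤ T := by
      rw [ht, mul_div_assoc', div_le_iff₀ hNpos, mul_comm]
      gcongr
    rw [hM]
    nlinarith
  have hstep := mul_le_log_integral_closedBall_sub hg.continuous hC hH ht0 hN1 hR
    (hM₀pos.trans_le hMM₀) (ε := η) fun x hx y hy => by
      have h1 := hlin t ht0 hNδ x (Metric.closedBall_subset_closedBall hMT hx) y hy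
      have h2 := mul_le_mul_of_nonneg_left (hyoung x y) ht0.le
      linarith
  have hnext : M₀ + ((k + 1 : ℕ) : ℝ) * (t * R) = M + t * R := by push_cast; ring
  have hDN : D / N ≤ t * η := by
    have : t * η = (D + 1) / N := by
      rw [ht, hT]; field_simp
    rw [this]
    gcongr
    linarith
  simp only [hnext] at hslope
  have h3 := le_of_mul_le_mul_left (hstep.trans (hslope.trans hDN)) ht0
  have h4 := (hM₀ M hMM₀).1
  have h5 : t * n ≤ η := by
    rw [lt_div_iff₀ (by positivity)] at hNη
    linarith
  linarith

lemma pos_of_strictConvexOn_of_homogeneous {C : EuclideanSpace ℝ (Fin n) → ℝ}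
    (hconv : StrictConvexOn ℝ Set.univ C) {q : ℝ} (hq : 1 < q)
    (hhom : ∀ lam : ℝ, 0 ≤ lam → ∀ x, C (lam • x) = lam ^ q * C x)
    {x : EuclideanSpace ℝ (Fin n)} (hx : x ≠ 0) : 0 < C x := by
  have h0 : C 0 = 0 := by
    simpa [Real.zero_rpow (by linarith : q ≠ 0)] using hhom 0 le_rfl 0
  have h1 := hconv.2 (Set.mem_univ x) (Set.mem_univ 0) hx (by norm_num : (0 : ℝ) < 1 / 2)
    (by norm_num : (0 : ℝ) < 1 / 2) (by norm_num)
  rw [smul_zero, add_zero, h0, smul_zero, add_zero, hhom _ (by norm_num), smul_eq_mul] at h1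
  have h2 : (1 / 2 : ℝ) ^ q ≤ 1 / 2 := by
    simpa using Real.rpow_le_rpow_of_exponent_ge (by norm_num : (0 : ℝ) < 1 / 2) (by norm_num) hq.le
  by_contra! h3
  nlinarith

lemma exists_pos_mul_norm_rpow_le {C : EuclideanSpace ℝ (Fin n) → ℝ}
    (hconv : StrictConvexOn ℝ Set.univ C) {q : ℝ} (hq : 1 < q)
    (hhom : ∀ lam : ℝ, 0 ≤ lam → ∀ x, C (lam • x) = lam ^ q * C x) :
    ∃ c > 0, ∀ x, c * ‖x‖ ^ q ≤ C x := by
  have hq0 : q ≠ 0 := by linarith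
  have hC : Continuous C := hconv.convexOn.locallyLipschitz.continuous
  have h0 : C 0 = 0 := by
    simpa [Real.zero_rpow hq0] using hhom 0 le_rfl 0
  obtain ⟨c, hc, hcC⟩ : ∃ c > 0, ∀ x ∈ Metric.sphere 0 1, c ≤ C x := by
    rcases (Metric.sphere (0 : EuclideanSpace ℝ (Fin n)) 1).eq_empty_or_nonempty with he | hne
    · exact ⟨1, one_pos, by simp [he]⟩
    obtain ⟨x, hx, hmin⟩ := (isCompact_sphere (0 : EuclideanSpace ℝ (Fin n)) 1).exists_isMinOn hne
      hC.continuousOn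
    exact ⟨C x, pos_of_strictConvexOn_of_homogeneous hconv hq hhom
      (ne_zero_of_mem_unit_sphere ⟨x, hx⟩), fun y hy => hmin hy⟩
  refine ⟨c, hc, fun x => ?_⟩
  rcases eq_or_ne x 0 with rfl | hx
  · simp [h0, Real.zero_rpow hq0]
  have hx' : 0 < ‖x‖ := norm_pos_iff.2 hx
  have h1 := hhom ‖x‖ hx'.le (‖x‖⁻¹ • x)
  rw [smul_inv_smul₀ hx'.ne'] at h1
  rw [h1, mul_comm]
  gcongr
  exact hcC _ (by simp [norm_smul, hx'.ne'])

lemma bddAbove_inner_sub {C : EuclideanSpace ℝ (Fin n) → ℝ} {p q c : ℝ}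
    (hpq : p.HolderConjugate q) (hc : 0 < c) (hC : ∀ x, c * ‖x‖ ^ q ≤ C x)
    (y : EuclideanSpace ℝ (Fin n)) : BddAbove (Set.range fun z => ⟪y, z⟫ - C z) := by
  have hq : 0 < q := hpq.symm.pos
  set κ := (c * q) ^ q⁻¹ with hκ
  have hκ0 : 0 < κ := by positivity
  refine ⟨(‖y‖ / κ) ^ p / p, ?_⟩
  rintro _ ⟨z, rfl⟩
  have h1 := Real.young_inequality_of_nonneg (a := ‖y‖ / κ) (b := κ * ‖z‖) (by positivity)
    (by positivity) hpq
  have h2 : (κ * ‖z‖) ^ q / q = c * ‖z‖ ^ q := by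
    rw [Real.mul_rpow hκ0.le (norm_nonneg _), hκ, ← Real.rpow_mul (by positivity),
      inv_mul_cancel₀ hq.ne', Real.rpow_one]
    field_simp
  have h3 : ‖y‖ / κ * (κ * ‖z‖) = ‖y‖ * ‖z‖ := by field_simp
  rw [h2, h3] at h1
  have h4 := real_inner_le_norm y z
  have h5 := hC z
  dsimp only
  linarith

lemma continuous_legendre {C : EuclideanSpace ℝ (Fin n) → ℝ}
    (hC : ∀ y, BddAbove (Set.range fun z => ⟪y, z⟫ - C z)) : Continuous (legendre C) := by
  have hconv : ConvexOn ℝ Set.univ (legendre C) := by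
    refine ⟨convex_univ, fun y _ y' _ a b ha hb hab => ciSup_le fun z => ?_⟩
    have h1 := mul_le_mul_of_nonneg_left (le_ciSup (hC y) z) ha
    have h2 := mul_le_mul_of_nonneg_left (le_ciSup (hC y') z) hb
    have h3 : C z = a * C z + b * C z := by rw [← add_mul, hab, one_mul]
    rw [inner_add_left, real_inner_smul_left, real_inner_smul_left, smul_eq_mul, smul_eq_mul]
    simp only [legendre] at h1 h2 ⊢
    linarith
  exact hconv.locallyLipschitz.continuous

/-- Scaled Young inequality for a homogeneous cost and its Legendre transform. -/
lemma inner_le_rpow_mul_add_rpow_mul_legendre {C : EuclideanSpace ℝ (Fin n) → ℝ} {p q : ℝ}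
    (hpq : p.HolderConjugate q)
    (hhom : ∀ lam : ℝ, 0 ≤ lam → ∀ x, C (lam • x) = lam ^ q * C x)
    (hC : ∀ y, BddAbove (Set.range fun z => ⟪y, z⟫ - C z)) {lam : ℝ} (hlam : 0 < lam)
    (y z : EuclideanSpace ℝ (Fin n)) :
    ⟪y, z⟫ ≤ lam ^ (-q) * C z + lam ^ p * legendre C y := by
  have h1 := mul_le_mul_of_nonneg_left (le_ciSup (hC y) (lam ^ (-p) • z))
    (Real.rpow_nonneg hlam.le p)
  have h2 : lam ^ p * lam ^ (-p) = 1 := by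
    rw [← Real.rpow_add hlam, add_neg_cancel, Real.rpow_zero]
  have h3 : lam ^ p * (lam ^ (-p)) ^ q = lam ^ (-q) := by
    rw [← Real.rpow_mul hlam.le, ← Real.rpow_add hlam]
    congr 1
    linarith [hpq.mul_eq_add]
  rw [hhom _ (Real.rpow_nonneg hlam.le _), real_inner_smul_right, mul_sub, ← mul_assoc, h2,
    one_mul, ← mul_assoc, h3] at h1
  simp only [legendre]
  linarith

lemma le_mul_log_of_forall_pos {m p a J L : ℝ} (hm : 0 < m) (hp : 0 < p) (hL : 0 < L)
    (hJ : 0 ≤ J)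
    (h : ∀ lam : ℝ, 0 < lam → a ≤ lam ^ p * J - m - m * Real.log lam - Real.log L) :
    a ≤ m / p * Real.log (p / (m * Real.exp (p - 1) * L ^ (p / m)) * J) := by
  rcases hJ.eq_or_lt with rfl | hJ
  · have h1 := h (Real.exp ((1 - m - a - Real.log L) / m)) (Real.exp_pos _)
    rw [Real.log_exp, mul_div_cancel₀ _ hm.ne'] at h1
    linarith
  have h1 := h ((m / (p * J)) ^ p⁻¹) (by positivity)
  rw [← Real.rpow_mul (by positivity), inv_mul_cancel₀ hp.ne', Real.rpow_one,
    Real.log_rpow (by positivity), Real.log_div hm.ne' (by positivity),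
    Real.log_mul hp.ne' hJ.ne'] at h1
  rw [Real.log_mul (by positivity) hJ.ne', Real.log_div hp.ne' (by positivity),
    Real.log_mul (by positivity) (by positivity), Real.log_mul hm.ne' (Real.exp_pos _).ne',
    Real.log_exp, Real.log_rpow hL]
  refine h1.trans (le_of_eq ?_)
  field_simp
  ring

end EuclideanLogSobolev

theorem euclidean_log_sobolev_optimized (n : ℕ) (hn : 0 < n)
    (C : EuclideanSpace ℝ (Fin n) → ℝ) (hconv : StrictConvexOn ℝ Set.univ C)
    (p q : ℝ) (hq : 1 < q) (hpq : 1 / p + 1 / q = 1)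
    (hhom : ∀ lam : ℝ, 0 ≤ lam → ∀ x, C (lam • x) = lam ^ q * C x)
    (hL : Integrable (fun x => Real.exp (-C x)))
    (g : EuclideanSpace ℝ (Fin n) → ℝ) (hg : ContDiff ℝ 1 g)
    (hint1 : Integrable (fun x => Real.exp (g x)))
    (hint2 : Integrable (fun x =>
      Real.exp (g x) * Real.log (Real.exp (g x) / ∫ y, Real.exp (g y))))
    (hint3 : Integrable (fun x => legendre C (-gradient g x) * Real.exp (g x))) :
    Ent volume (fun x => Real.exp (g x)) ≤
      ((n : ℝ) / p) * (∫ x, Real.exp (g x)) *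
        Real.log ((p / ((n : ℝ) * Real.exp (p - 1) *
            (∫ x, Real.exp (-C x)) ^ (p / (n : ℝ)))) *
          ((∫ x, legendre C (-gradient g x) * Real.exp (g x)) / ∫ x, Real.exp (g x))) := by
  have hconj : p.HolderConjugate q := by
    refine (Real.holderConjugate_iff.2 ⟨hq, ?_⟩).symm
    simpa [add_comm] using hpq
  have hp : 0 < p := hconj.pos
  have hC : Continuous C := hconv.convexOn.locallyLipschitz.continuous
  obtain ⟨c, hc, hcC⟩ := exists_pos_mul_norm_rpow_le hconv hq hhom
  have hbdd := bddAbove_inner_sub hconj hc hcC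
  have hgrad : Continuous (gradient g) :=
    (InnerProductSpace.toDual ℝ _).symm.continuous.comp (hg.continuous_fderiv one_ne_zero)
  have hH : Continuous fun x => legendre C (-gradient g x) :=
    (continuous_legendre hbdd).comp hgrad.neg
  have hHnn : ∀ y, 0 ≤ legendre C y := fun y => by
    have hC0 : C 0 = 0 := by
      simpa [Real.zero_rpow (by linarith : q ≠ 0)] using hhom 0 le_rfl 0
    simpa [legendre, hC0] using le_ciSup (hbdd y) 0
  set Z := ∫ x, Real.exp (g x)
  set Λ := ∫ x, Real.exp (-C x)
  set I := ∫ x, legendre C (-gradient g x) * Real.exp (g x)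
  have hZ : 0 < Z := integral_exp_pos hint1
  have hΛ : 0 < Λ := integral_exp_pos hL
  have hI : 0 ≤ I := integral_nonneg fun x => mul_nonneg (hHnn _) (Real.exp_pos _).le
  set a := Ent volume (fun x => Real.exp (g x))
  suffices h : a / Z ≤ n / p * Real.log (p / (n * Real.exp (p - 1) * Λ ^ (p / n)) * (I / Z)) by
    rw [div_le_iff₀ hZ] at h
    linarith
  refine le_mul_log_of_forall_pos (by exact_mod_cast hn) hp hΛ (by positivity) fun lam hlam => ?_
  have hlog : ∀ x, Real.log (Real.exp (g x) / Z) = g x - Real.log Z := fun x => by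
    rw [Real.log_div (Real.exp_pos _).ne' hZ.ne', Real.log_exp]
  have hsplit : ∀ x, Real.exp (g x) * (g x - lam ^ p * legendre C (-gradient g x)) =
      Real.exp (g x) * Real.log (Real.exp (g x) / Z) + Real.log Z * Real.exp (g x) -
        lam ^ p * (legendre C (-gradient g x) * Real.exp (g x)) := fun x => by
    rw [hlog]; ring
  have hscale : ∀ x, Real.exp (-(lam ^ (-q) * C x)) = Real.exp (-C (lam⁻¹ • x)) := fun x => by
    rw [hhom _ (by positivity), Real.rpow_neg hlam.le, Real.inv_rpow hlam.le]
  have hsum : Integrable fun x =>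
      Real.exp (g x) * Real.log (Real.exp (g x) / Z) + Real.log Z * Real.exp (g x) :=
    hint2.add (hint1.const_mul _)
  have key := log_sobolev_of_young hg (C := fun x => lam ^ (-q) * C x)
    (H := fun x => lam ^ p * legendre C (-gradient g x)) (by fun_prop) (by fun_prop)
    (by simp only [hscale]; exact hL.comp_smul (inv_ne_zero hlam.ne')) hint1
    (by simp only [hsplit]; exact hsum.sub (hint3.const_mul _))
    fun x y => by
      have h1 := inner_le_rpow_mul_add_rpow_mul_legendre hconj hhom hbdd hlam (-gradient g x) y
      rwa [inner_neg_left, ← InnerProductSpace.toDual_apply_apply (𝕜 := ℝ), toDual_gradient] at h1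
  simp only [hsplit, hscale] at key
  rw [integral_sub hsum (hint3.const_mul _),
    integral_add hint2 (hint1.const_mul _), integral_const_mul, integral_const_mul,
    Measure.integral_comp_inv_smul_of_nonneg volume (fun x => Real.exp (-C x)) hlam.le,
    finrank_euclideanSpace, Fintype.card_fin, smul_eq_mul,
    Real.log_mul (by positivity) hΛ.ne', Real.log_pow] at key
  have e : (a + Real.log Z * Z - lam ^ p * I) / Z = a / Z + Real.log Z - lam ^ p * (I / Z) := by
    field_simp
  change n + (a + Real.log Z * Z - lam ^ p * I) / Z - Real.log Z + _ ≤ 0 at key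
  rw [e] at key
  linarith
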